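/- Let (α, μ) be a finite measure space and let f and f_n (n ∈ ℕ) be measurable real-valued functions on α that are nonnegative μ-a.e. Assume: (i) ∫ (√(f_n) − √f)² dμ → 0 as n → ∞; (ii) there exists B such that ∫ f_n^{3/2} dμ ≤ B for all n; (iii) ∫ f^{3/2} dμ < ∞. Then ∫ √(f_n) · (1 + f^{3/4}) dμ → ∫ √f · (1 + f^{3/4}) dμ as n → ∞. -/

import Mathlib

open MeasureTheory Filter

/-- If `uₙ → u` in `L²`, then `∫ uₙ g → ∫ u g` for every `g` in `L²`. -/
theorem tendsto_integral_mul_of_tendsto_integral_sub_sq {α : Type*} [MeasurableSpace α]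
    {μ : Measure α} {u g : α → ℝ} {un : ℕ → α → ℝ} (hu : MemLp u 2 μ)
    (hun : ∀ n, MemLp (un n) 2 μ) (hg : MemLp g 2 μ)
    (h : Tendsto (fun n => ∫ x, (un n x - u x) ^ 2 ∂μ) atTop (nhds 0)) :
    Tendsto (fun n => ∫ x, un n x * g x ∂μ) atTop (nhds (∫ x, u x * g x ∂μ)) := by
  have hbound : Tendsto (fun n => Real.sqrt (∫ x, (un n x - u x) ^ 2 ∂μ) *
      Real.sqrt (∫ x, g x ^ 2 ∂μ)) atTop (nhds 0) := by
    simpa using (h.sqrt).mul_const (Real.sqrt (∫ x, g x ^ 2 ∂μ))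
  rw [tendsto_iff_norm_sub_tendsto_zero]
  refine squeeze_zero (fun _ => norm_nonneg _) (fun n => ?_) hbound
  have hint : ∀ {v : α → ℝ}, MemLp v 2 μ → Integrable (fun x => v x * g x) μ :=
    fun hv => hv.integrable_mul hg
  rw [← integral_sub (hint (hun n)) (hint hu)]
  refine (norm_integral_le_integral_norm _).trans ?_
  have hholder := integral_mul_norm_le_Lp_mul_Lq (μ := μ) (f := un n - u) (g := g)
    Real.HolderConjugate.two_two (by simpa using (hun n).sub hu) (by simpa using hg)
  simpa [← sub_mul, Real.sqrt_eq_rpow] using hholder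

/-- On a finite measure space, `√f` is in `L²` if `f ^ p` is integrable for some `p ≥ 1`. -/
theorem memLp_two_sqrt_of_integrable_rpow {α : Type*} [MeasurableSpace α] {μ : Measure α}
    [IsFiniteMeasure μ] {f : α → ℝ} {p : ℝ} (hp : 1 ≤ p) (hfm : Measurable f)
    (hf0 : ∀ᵐ x ∂μ, 0 ≤ f x) (hf : Integrable (fun x => f x ^ p) μ) :
    MemLp (fun x => Real.sqrt (f x)) 2 μ := by
  rw [memLp_two_iff_integrable_sq hfm.sqrt.aestronglyMeasurable]
  refine ((integrable_const (1 : ℝ)).add hf).mono' (by fun_prop) ?_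
  filter_upwards [hf0] with x hx
  rw [Real.sq_sqrt hx, Real.norm_of_nonneg hx, Pi.add_apply]
  have hpow := Real.rpow_nonneg hx p
  rcases le_total (f x) 1 with h1 | h1
  · linarith
  · linarith [Real.self_le_rpow_of_one_le h1 hp]

/-- On a finite measure space, if `√fₙ → √f` in `L²(μ)`, the `fₙ` are uniformly
bounded in `L^{3/2}(μ)`, and `f ∈ L^{3/2}(μ)`, then
`∫ √fₙ · (1 + f^{3/4}) dμ → ∫ √f · (1 + f^{3/4}) dμ`. -/
theorem integral_sqrt_mul_one_add_rpow_tendsto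
    (α : Type*) [MeasurableSpace α] (μ : Measure α) [IsFiniteMeasure μ]
    (f : α → ℝ) (fn : ℕ → α → ℝ)
    (hfm : Measurable f) (hfnm : ∀ n, Measurable (fn n))
    (hf0 : ∀ᵐ x ∂μ, 0 ≤ f x) (hfn0 : ∀ n, ∀ᵐ x ∂μ, 0 ≤ fn n x)
    (hL2 : Tendsto (fun n => ∫ x, (Real.sqrt (fn n x) - Real.sqrt (f x)) ^ 2 ∂μ)
      atTop (nhds 0))
    (hfn32 : ∀ n, Integrable (fun x => fn n x ^ ((3 : ℝ) / 2)) μ)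
    (hB : ∃ B : ℝ, ∀ n, ∫ x, fn n x ^ ((3 : ℝ) / 2) ∂μ ≤ B)
    (hf32 : Integrable (fun x => f x ^ ((3 : ℝ) / 2)) μ) :
    Tendsto (fun n =>
        ∫ x, Real.sqrt (fn n x) * (1 + f x ^ ((3 : ℝ) / 4)) ∂μ)
      atTop (nhds (∫ x, Real.sqrt (f x) * (1 + f x ^ ((3 : ℝ) / 4)) ∂μ)) := by
  have hg : MemLp (fun x => 1 + f x ^ ((3 : ℝ) / 4)) 2 μ := by
    refine (memLp_const (1 : ℝ)).add ?_
    rw [memLp_two_iff_integrable_sq (hfm.pow_const _).aestronglyMeasurable]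
    refine hf32.congr ?_
    filter_upwards [hf0] with x hx
    rw [← Real.rpow_mul_natCast hx]
    norm_num
  exact tendsto_integral_mul_of_tendsto_integral_sub_sq
    (memLp_two_sqrt_of_integrable_rpow (by norm_num) hfm hf0 hf32)
    (fun n => memLp_two_sqrt_of_integrable_rpow (by norm_num) (hfnm n) (hfn0 n) (hfn32 n))
    hg hL2
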